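/- arXiv:2406.01965 — 9 statements merged into one kernel-verified Lean document; each statement's English description precedes it below -/
import Mathlib

section
/- Let P be a real n×m matrix each of whose columns has Euclidean norm at most 1, let H be a symmetric positive definite m×m matrix with H ⪯ M₂ I_m for some M₂ > 0, let g ∈ ℝ^m, and set d = −H g. Then ‖P d‖² ≤ −m M₂ (P d)ᵀ (P' g') holds in the form: ‖P d‖² ≤ m M₂ (−dᵀ g). In particular, if g = Pᵀ∇f(x) for a differentiable f : ℝ^n → ℝ, then ‖P d‖² ≤ −m M₂ (P d)ᵀ ∇f(x). -/
open Matrix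
open scoped RealInnerProductSpace

/-- A symmetric positive operator `T` with `T ≤ M` satisfies `T ^ 2 ≤ M T`. -/
theorem LinearMap.IsPositive.norm_sq_apply_le {E : Type*} [NormedAddCommGroup E]
    [InnerProductSpace ℝ E] {T : E →ₗ[ℝ] E} (hT : T.IsPositive) {M : ℝ} (hM : 0 < M)
    (hle : ∀ u, ⟪T u, u⟫ ≤ M * ‖u‖ ^ 2) (v : E) : ‖T v‖ ^ 2 ≤ M * ⟪T v, v⟫ := by
  have key : 0 ≤ ⟪T (M • v - T v), M • v - T v⟫ := hT.inner_nonneg_left _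
  have hsymm : ⟪T (T v), v⟫ = ‖T v‖ ^ 2 := by
    rw [hT.isSymmetric (T v) v, real_inner_self_eq_norm_sq]
  have hle' := hle (T v)
  simp only [map_sub, map_smul, inner_sub_left, inner_sub_right, real_inner_smul_left,
    real_inner_smul_right, hsymm, real_inner_self_eq_norm_sq] at key
  have : 0 ≤ M * (M * ⟪T v, v⟫ - ‖T v‖ ^ 2) := by linarith
  linarith [nonneg_of_mul_nonneg_right this hM]

/-- A linear map sending the standard basis into the unit ball satisfies
`‖L v‖ ^ 2 ≤ card ι * ‖v‖ ^ 2`. -/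
theorem EuclideanSpace.norm_sq_apply_le_card_mul {ι E : Type*} [Fintype ι] [DecidableEq ι]
    [SeminormedAddCommGroup E] [NormedSpace ℝ E] (L : EuclideanSpace ℝ ι →ₗ[ℝ] E)
    (hL : ∀ j, ‖L (EuclideanSpace.single j 1)‖ ≤ 1) (v : EuclideanSpace ℝ ι) :
    ‖L v‖ ^ 2 ≤ Fintype.card ι * ‖v‖ ^ 2 := by
  have hv : L v = ∑ j, v j • L (EuclideanSpace.single j 1) := by
    conv_lhs => rw [← (EuclideanSpace.basisFun ι ℝ).sum_repr v]
    simp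
  have hnorm : ‖L v‖ ≤ ∑ j, |v j| := by
    rw [hv]
    refine (norm_sum_le _ _).trans (Finset.sum_le_sum fun j _ => ?_)
    rw [norm_smul, Real.norm_eq_abs]
    exact mul_le_of_le_one_right (abs_nonneg _) (hL j)
  calc ‖L v‖ ^ 2 ≤ (∑ j, |v j|) ^ 2 := by gcongr
    _ ≤ Fintype.card ι * ∑ j, |v j| ^ 2 := sq_sum_le_card_mul_sum_sq
    _ = Fintype.card ι * ‖v‖ ^ 2 := by simp [EuclideanSpace.real_norm_sq_eq]

/-- Let `P` be an `n × m` real matrix whose columns have Euclidean norm at most 1, let `H` be a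
symmetric positive definite `m × m` matrix with `H ⪯ M₂ I`, `M₂ > 0`, and `d = -H g`. Then
`‖P d‖² ≤ m M₂ (-dᵀ g)`; in particular if `g = Pᵀ ∇f(x)` for a differentiable `f`, then
`‖P d‖² ≤ -m M₂ (P d)ᵀ ∇f(x)`. -/
theorem stmt1 {n m : ℕ} (P : Matrix (Fin n) (Fin m) ℝ)
    (hcol : ∀ j : Fin m, ‖Matrix.toEuclideanLin P (EuclideanSpace.single j (1 : ℝ))‖ ≤ 1)
    (H : Matrix (Fin m) (Fin m) ℝ) (hH : H.PosDef)
    (M₂ : ℝ) (hM₂ : 0 < M₂)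
    (hHle : (M₂ • (1 : Matrix (Fin m) (Fin m) ℝ) - H).PosSemidef)
    (g d : EuclideanSpace ℝ (Fin m))
    (hd : d = -(Matrix.toEuclideanLin H g)) :
    ‖Matrix.toEuclideanLin P d‖ ^ 2 ≤ (m : ℝ) * M₂ * (-⟪d, g⟫) ∧
      ∀ (f : EuclideanSpace ℝ (Fin n) → ℝ) (x : EuclideanSpace ℝ (Fin n)),
        Differentiable ℝ f →
        g = Matrix.toEuclideanLin Pᵀ (gradient f x) →
        ‖Matrix.toEuclideanLin P d‖ ^ 2 ≤
          -((m : ℝ) * M₂) * ⟪Matrix.toEuclideanLin P d, gradient f x⟫ := by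
  have hT : (Matrix.toEuclideanLin H).IsPositive :=
    Matrix.isPositive_toEuclideanLin_iff.mpr hH.posSemidef
  have hle (u : EuclideanSpace ℝ (Fin m)) :
      ⟪Matrix.toEuclideanLin H u, u⟫ ≤ M₂ * ‖u‖ ^ 2 := by
    have h := (Matrix.isPositive_toEuclideanLin_iff.mpr hHle).inner_nonneg_left u
    have hone : Matrix.toEuclideanLin (1 : Matrix (Fin m) (Fin m) ℝ) u = u := by
      ext i
      simp
    rw [map_sub, map_smul, LinearMap.sub_apply, LinearMap.smul_apply, hone, inner_sub_left,
      real_inner_smul_left, real_inner_self_eq_norm_sq] at h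
    linarith
  have hmain : ‖Matrix.toEuclideanLin P d‖ ^ 2 ≤ (m : ℝ) * M₂ * (-⟪d, g⟫) := by
    calc ‖Matrix.toEuclideanLin P d‖ ^ 2 ≤ m * ‖d‖ ^ 2 := by
          simpa using EuclideanSpace.norm_sq_apply_le_card_mul _ hcol d
      _ ≤ m * (M₂ * (-⟪d, g⟫)) := by
          gcongr
          simpa [hd] using hT.norm_sq_apply_le hM₂ hle g
      _ = m * M₂ * (-⟪d, g⟫) := by ring
  refine ⟨hmain, fun f x _ hg => hmain.trans_eq ?_⟩
  have hadj : ⟪d, g⟫ = ⟪Matrix.toEuclideanLin P d, gradient f x⟫ := by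
    rw [hg, ← Matrix.conjTranspose_eq_transpose_of_trivial,
      Matrix.toEuclideanLin_conjTranspose_eq_adjoint, LinearMap.adjoint_inner_right]
  rw [hadj]
  ring
end

section
/- Let g ∈ ℝ^n be nonzero, let Q be a real n×d' matrix with Q Qᵀ g ≠ 0, and let P be a real n×m matrix one of whose columns equals Q Qᵀ g / ‖Q Qᵀ g‖. Suppose that ‖Qᵀ g‖² ≥ (1−ε) d' ‖g‖² for some ε ∈ (0,1), and that ‖Q Qᵀ‖_op ≤ C n for some C > 0. Then ‖Pᵀ g‖ ≥ ((1−ε) d' / (C n)) ‖g‖. -/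
open Matrix

/-- The operator norm of a matrix acting between Euclidean spaces. -/
noncomputable def matOpNorm {n m : ℕ} (A : Matrix (Fin n) (Fin m) ℝ) : ℝ :=
  ‖LinearMap.toContinuousLinearMap (Matrix.toEuclideanLin A)‖

theorem norm_toEuclideanLin_le_matOpNorm {n m : ℕ} (A : Matrix (Fin n) (Fin m) ℝ)
    (x : EuclideanSpace ℝ (Fin m)) :
    ‖Matrix.toEuclideanLin A x‖ ≤ matOpNorm A * ‖x‖ :=
  (LinearMap.toContinuousLinearMap (Matrix.toEuclideanLin A)).le_opNorm x

theorem inner_toEuclideanLin_transpose {n m : ℕ} (A : Matrix (Fin n) (Fin m) ℝ)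
    (x : EuclideanSpace ℝ (Fin m)) (y : EuclideanSpace ℝ (Fin n)) :
    inner ℝ x (Matrix.toEuclideanLin Aᵀ y) = inner ℝ (Matrix.toEuclideanLin A x) y := by
  rw [← Matrix.conjTranspose_eq_transpose_of_trivial,
    Matrix.toEuclideanLin_conjTranspose_eq_adjoint, LinearMap.adjoint_inner_right]

theorem inner_toEuclideanLin_mul_transpose_self {n m : ℕ} (A : Matrix (Fin n) (Fin m) ℝ)
    (x : EuclideanSpace ℝ (Fin n)) :
    inner ℝ (Matrix.toEuclideanLin (A * Aᵀ) x) x = ‖Matrix.toEuclideanLin Aᵀ x‖ ^ 2 := by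
  have h : Matrix.toEuclideanLin (A * Aᵀ) x =
      Matrix.toEuclideanLin A (Matrix.toEuclideanLin Aᵀ x) := by
    simp [Matrix.toLpLin_apply, Matrix.mulVec_mulVec]
  rw [h, ← inner_toEuclideanLin_transpose, real_inner_self_eq_norm_sq]

/-- Let `g ≠ 0`, `Q` an `n × d'` matrix with `QQᵀg ≠ 0`, and `P` an `n × m` matrix one of whose
columns is `QQᵀg/‖QQᵀg‖`. If `‖Qᵀg‖² ≥ (1-ε) d' ‖g‖²` and `‖QQᵀ‖_op ≤ C n`, then
`‖Pᵀg‖ ≥ ((1-ε) d' / (C n)) ‖g‖`. -/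
theorem stmt4 {n m d' : ℕ} (g : EuclideanSpace ℝ (Fin n)) (hg : g ≠ 0)
    (Q : Matrix (Fin n) (Fin d') ℝ)
    (hQg : Matrix.toEuclideanLin (Q * Qᵀ) g ≠ 0)
    (P : Matrix (Fin n) (Fin m) ℝ)
    (hcol : ∃ j : Fin m,
      Matrix.toEuclideanLin P (EuclideanSpace.single j (1 : ℝ)) =
        ‖Matrix.toEuclideanLin (Q * Qᵀ) g‖⁻¹ • Matrix.toEuclideanLin (Q * Qᵀ) g)
    (ε : ℝ) (hε : ε ∈ Set.Ioo (0 : ℝ) 1)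
    (hlow : (1 - ε) * d' * ‖g‖ ^ 2 ≤ ‖Matrix.toEuclideanLin Qᵀ g‖ ^ 2)
    (C : ℝ) (hC : 0 < C)
    (hop : matOpNorm (Q * Qᵀ) ≤ C * n) :
    (1 - ε) * d' / (C * n) * ‖g‖ ≤ ‖Matrix.toEuclideanLin Pᵀ g‖ := by
  obtain ⟨j, hj⟩ := hcol
  set w := Matrix.toEuclideanLin (Q * Qᵀ) g with hw
  have hg' : 0 < ‖g‖ := norm_pos_iff.mpr hg
  have hw' : 0 < ‖w‖ := norm_pos_iff.mpr hQg
  have hwle : ‖w‖ ≤ C * n * ‖g‖ :=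
    (norm_toEuclideanLin_le_matOpNorm _ g).trans (by gcongr)
  have hCn : 0 < C * n := pos_of_mul_pos_left (hw'.trans_le hwle) hg'.le
  have hPg : ‖Matrix.toEuclideanLin Qᵀ g‖ ^ 2 / ‖w‖ ≤ ‖Matrix.toEuclideanLin Pᵀ g‖ := by
    have h := real_inner_le_norm (EuclideanSpace.single j (1 : ℝ)) (Matrix.toEuclideanLin Pᵀ g)
    rw [inner_toEuclideanLin_transpose, hj, real_inner_smul_left, hw,
      inner_toEuclideanLin_mul_transpose_self, ← hw] at h
    simpa [div_eq_inv_mul] using h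
  have hε' : 0 ≤ 1 - ε := sub_nonneg.mpr hε.2.le
  calc (1 - ε) * d' / (C * n) * ‖g‖
      = (1 - ε) * d' * ‖g‖ ^ 2 / (C * n * ‖g‖) := by field_simp
    _ ≤ ‖Matrix.toEuclideanLin Qᵀ g‖ ^ 2 / ‖w‖ := by gcongr
    _ ≤ ‖Matrix.toEuclideanLin Pᵀ g‖ := hPg
end

section
/- Let f : ℝ^n → ℝ be differentiable and bounded below by f*, and let (x_k)_{k≥0} be a sequence in ℝ^n such that for some γ > 0 and all k, f(x_{k+1}) − f(x_k) ≤ −γ ‖∇f(x_k)‖². Then for every k ≥ 0, min_{0 ≤ j ≤ k} ‖∇f(x_j)‖ ≤ √( (f(x₀) − f*) / (γ (k+1)) ). -/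
/-- A sequence whose decrease at each step is at least `γ * g i ^ 2` decreases over `m` steps
by at least `γ` times the sum of these squares. -/
theorem mul_sum_sq_le_sub_of_sub_le {u g : ℕ → ℝ} {γ : ℝ}
    (h : ∀ i, u (i + 1) - u i ≤ -γ * g i ^ 2) (m : ℕ) :
    γ * ∑ i ∈ Finset.range m, g i ^ 2 ≤ u 0 - u m := by
  rw [← Finset.sum_range_sub', Finset.mul_sum]
  exact Finset.sum_le_sum fun i _ => by linarith [h i]

/-- Let `f` be differentiable and bounded below by `f*`, and let `(x_k)` satisfy
`f(x_{k+1}) - f(x_k) ≤ -γ ‖∇f(x_k)‖²` with `γ > 0`. Then for every `k`,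
`min_{0 ≤ j ≤ k} ‖∇f(x_j)‖ ≤ √((f(x₀) - f*) / (γ (k+1)))`. -/
theorem stmt6 {n : ℕ} (f : EuclideanSpace ℝ (Fin n) → ℝ)
    (hf : Differentiable ℝ f)
    (fstar : ℝ) (hbound : ∀ y, fstar ≤ f y)
    (x : ℕ → EuclideanSpace ℝ (Fin n))
    (γ : ℝ) (hγ : 0 < γ)
    (hdec : ∀ k : ℕ, f (x (k + 1)) - f (x k) ≤ -γ * ‖gradient f (x k)‖ ^ 2) :
    ∀ k : ℕ,
      (Finset.range (k + 1)).inf' (by simp) (fun j => ‖gradient f (x j)‖) ≤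
        Real.sqrt ((f (x 0) - fstar) / (γ * (k + 1))) := by
  intro k
  set m := (Finset.range (k + 1)).inf' (by simp) (fun j => ‖gradient f (x j)‖)
  have hm_nonneg : 0 ≤ m := Finset.le_inf' _ _ fun j _ => norm_nonneg _
  have hsum : (k + 1) * m ^ 2 ≤ ∑ j ∈ Finset.range (k + 1), ‖gradient f (x j)‖ ^ 2 := by
    have hle : ∀ j ∈ Finset.range (k + 1), m ^ 2 ≤ ‖gradient f (x j)‖ ^ 2 := fun j hj =>
      pow_le_pow_left₀ hm_nonneg (Finset.inf'_le _ hj) 2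
    simpa using Finset.card_nsmul_le_sum _ _ _ hle
  have htel := mul_sum_sq_le_sub_of_sub_le (u := fun i => f (x i)) hdec (k + 1)
  apply Real.le_sqrt_of_sq_le
  rw [le_div_iff₀ (by positivity)]
  linarith [hbound (x (k + 1)), mul_le_mul_of_nonneg_left hsum hγ.le]
end

section
/- Let f : ℝ^n → ℝ be convex and differentiable, attaining its minimum value f* on a nonempty set Ω of minimizers. Let x₀ ∈ ℝ^n and suppose R₀ > 0 satisfies: for every x with f(x) ≤ f(x₀) there exists x* ∈ Ω with ‖x − x*‖ ≤ R₀. Let (x_k)_{k≥0} start at x₀ and satisfy, for some γ > 0 and all k, f(x_{k+1}) − f(x_k) ≤ −γ ‖∇f(x_k)‖². Then for every k ≥ 1, f(x_k) − f* ≤ (f(x₀) − f*) / (1 + γ k (f(x₀) − f*) / R₀²). -/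
open AffineMap in
/-- First-order characterisation: a convex function lies above its tangent planes. -/
theorem ConvexOn.add_inner_gradient_le {E : Type*} [NormedAddCommGroup E] [InnerProductSpace ℝ E]
    [CompleteSpace E] {f : E → ℝ} (hconv : ConvexOn ℝ Set.univ f) {x : E}
    (hf : DifferentiableAt ℝ f x) (y : E) :
    f x + inner ℝ (gradient f x) (y - x) ≤ f y := by
  have hg : ConvexOn ℝ Set.univ (f ∘ lineMap (k := ℝ) x y) := by
    simpa using hconv.comp_affineMap (lineMap (k := ℝ) x y)
  have hd : HasDerivAt (f ∘ lineMap (k := ℝ) x y) (inner ℝ (gradient f x) (y - x)) 0 := by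
    have h0 : HasFDerivAt f (InnerProductSpace.toDual ℝ E (gradient f x))
        (lineMap (k := ℝ) x y 0) := by
      simpa using hf.hasGradientAt.hasFDerivAt
    simpa using h0.comp_hasDerivAt (0 : ℝ) hasDerivAt_lineMap
  have := hg.le_slope_of_hasDerivAt (Set.mem_univ 0) (Set.mem_univ 1) one_pos hd
  simp only [slope_def_field, Function.comp_apply, lineMap_apply_one, lineMap_apply_zero, sub_zero,
    div_one] at this
  linarith

/-- The optimality gap of a convex function is at most the gradient norm times the distance. -/
theorem ConvexOn.sub_le_norm_gradient_mul {E : Type*} [NormedAddCommGroup E]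
    [InnerProductSpace ℝ E] [CompleteSpace E] {f : E → ℝ} (hconv : ConvexOn ℝ Set.univ f) {x : E}
    (hf : DifferentiableAt ℝ f x) (y : E) :
    f x - f y ≤ ‖gradient f x‖ * ‖x - y‖ := by
  have h₁ := hconv.add_inner_gradient_le hf y
  have h₂ := real_inner_le_norm (gradient f x) (x - y)
  rw [← neg_sub x y, inner_neg_right] at h₁
  linarith

/-- A nonnegative sequence with `a (k + 1) ≤ a k - c * a k ^ 2` decays at rate `1 / k`. -/
theorem mul_one_add_le_of_le_sub_sq {a : ℕ → ℝ} {c : ℝ} (hc : 0 ≤ c) (ha : ∀ k, 0 ≤ a k)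
    (hstep : ∀ k, a (k + 1) ≤ a k - c * a k ^ 2) (k : ℕ) :
    a k * (1 + c * k * a 0) ≤ a 0 := by
  induction k with
  | zero => simp
  | succ k ih =>
    have hle : a (k + 1) ≤ a k := by nlinarith [hstep k, mul_nonneg hc (sq_nonneg (a k))]
    rcases (ha k).eq_or_lt with h | h
    · have h0 : a (k + 1) = 0 := le_antisymm (h ▸ hle) (ha _)
      simpa [h0] using ha 0
    · have hb : a (k + 1) * (1 + c * a k) ≤ a k := by
        nlinarith [hstep k, mul_le_mul_of_nonneg_left hle (mul_nonneg hc h.le)]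
      refine le_of_mul_le_mul_left ?_ h
      push_cast
      calc a k * (a (k + 1) * (1 + c * (k + 1) * a 0))
          = a (k + 1) * (a k * (1 + c * k * a 0)) + a (k + 1) * (c * a k * a 0) := by ring
        _ ≤ a (k + 1) * a 0 + a (k + 1) * (c * a k * a 0) := by
            gcongr
            exact ha _
        _ = a (k + 1) * (1 + c * a k) * a 0 := by ring
        _ ≤ a k * a 0 := mul_le_mul_of_nonneg_right hb (ha 0)

/-- Let `f` be convex and differentiable with minimum value `f*` attained on the nonempty set `Ω`
of minimizers, and let `R₀ > 0` bound the distance from any point of the initial sublevel set to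
`Ω`. If `(x_k)` starts at `x₀` and satisfies `f(x_{k+1}) - f(x_k) ≤ -γ‖∇f(x_k)‖²` with `γ > 0`,
then for `k ≥ 1`, `f(x_k) - f* ≤ (f(x₀) - f*) / (1 + γ k (f(x₀) - f*) / R₀²)`. -/
theorem stmt7 {n : ℕ} (f : EuclideanSpace ℝ (Fin n) → ℝ)
    (hconv : ConvexOn ℝ Set.univ f) (hf : Differentiable ℝ f)
    (fstar : ℝ) (hmin : ∀ y, fstar ≤ f y)
    (Ω : Set (EuclideanSpace ℝ (Fin n))) (hΩ : Ω = {y | f y = fstar})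
    (hne : Ω.Nonempty)
    (x : ℕ → EuclideanSpace ℝ (Fin n))
    (R₀ : ℝ) (hR₀ : 0 < R₀)
    (hR : ∀ y, f y ≤ f (x 0) → ∃ z ∈ Ω, ‖y - z‖ ≤ R₀)
    (γ : ℝ) (hγ : 0 < γ)
    (hdec : ∀ k : ℕ, f (x (k + 1)) - f (x k) ≤ -γ * ‖gradient f (x k)‖ ^ 2) :
    ∀ k : ℕ, 1 ≤ k →
      f (x k) - fstar ≤
        (f (x 0) - fstar) / (1 + γ * k * (f (x 0) - fstar) / R₀ ^ 2) := by
  intro k _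
  have hanti : Antitone fun k => f (x k) := antitone_nat_of_succ_le fun k => by
    nlinarith [hdec k, mul_nonneg hγ.le (sq_nonneg ‖gradient f (x k)‖)]
  have hgap (k : ℕ) : f (x k) - fstar ≤ ‖gradient f (x k)‖ * R₀ := by
    obtain ⟨z, hz, hzR⟩ := hR (x k) (hanti k.zero_le)
    have hfz : f z = fstar := by simpa [hΩ] using hz
    have := hconv.sub_le_norm_gradient_mul (hf (x k)) z
    rw [hfz] at this
    exact this.trans (by gcongr)
  have ha (k : ℕ) : 0 ≤ f (x k) - fstar := sub_nonneg.2 (hmin _)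
  have hstep (k : ℕ) :
      f (x (k + 1)) - fstar ≤ f (x k) - fstar - γ / R₀ ^ 2 * (f (x k) - fstar) ^ 2 := by
    have hsq : γ / R₀ ^ 2 * (f (x k) - fstar) ^ 2 ≤ γ * ‖gradient f (x k)‖ ^ 2 := by
      rw [div_mul_eq_mul_div, div_le_iff₀ (by positivity), mul_assoc, ← mul_pow]
      gcongr
      · exact ha k
      · exact hgap k
    linarith [hdec k]
  have h0 := ha 0
  rw [le_div_iff₀ (by positivity)]
  rw [show γ * k * (f (x 0) - fstar) / R₀ ^ 2 = γ / R₀ ^ 2 * k * (f (x 0) - fstar) by ring]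
  exact mul_one_add_le_of_le_sub_sq (a := fun k => f (x k) - fstar) (by positivity) ha hstep k
end

section
/- Let f : ℝ^n → ℝ be differentiable with minimum value f* and suppose f satisfies the Polyak–Łojasiewicz condition with constant σ > 0: ‖∇f(x)‖² ≥ 2σ (f(x) − f*) for all x ∈ ℝ^n. Let (x_k)_{k≥0} satisfy, for some γ > 0 with 2σγ < 1 and all k, f(x_{k+1}) − f(x_k) ≤ −γ ‖∇f(x_k)‖². Then for every k ≥ 0, f(x_k) − f* ≤ (1 − 2σγ)^k (f(x₀) − f*). -/
/-- Let `f` be differentiable with minimum value `f*` satisfying the Polyak–Łojasiewicz condition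
`‖∇f(x)‖² ≥ 2σ(f(x) - f*)` with `σ > 0`. If `(x_k)` satisfies
`f(x_{k+1}) - f(x_k) ≤ -γ‖∇f(x_k)‖²` with `γ > 0` and `2σγ < 1`, then
`f(x_k) - f* ≤ (1 - 2σγ)^k (f(x₀) - f*)`. -/
theorem stmt9 {n : ℕ} (f : EuclideanSpace ℝ (Fin n) → ℝ)
    (hf : Differentiable ℝ f)
    (fstar : ℝ) (hmin : ∀ y, fstar ≤ f y)
    (σ : ℝ) (hσ : 0 < σ)
    (hPL : ∀ y, 2 * σ * (f y - fstar) ≤ ‖gradient f y‖ ^ 2)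
    (x : ℕ → EuclideanSpace ℝ (Fin n))
    (γ : ℝ) (hγ : 0 < γ) (hσγ : 2 * σ * γ < 1)
    (hdec : ∀ k : ℕ, f (x (k + 1)) - f (x k) ≤ -γ * ‖gradient f (x k)‖ ^ 2) :
    ∀ k : ℕ, f (x k) - fstar ≤ (1 - 2 * σ * γ) ^ k * (f (x 0) - fstar) := by
  intro k
  induction k with
  | zero => simp
  | succ k ih =>
    have hstep : f (x (k + 1)) - fstar ≤ (1 - 2 * σ * γ) * (f (x k) - fstar) := by
      linarith [hdec k, mul_le_mul_of_nonneg_left (hPL (x k)) hγ.le]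
    calc f (x (k + 1)) - fstar ≤ (1 - 2 * σ * γ) * (f (x k) - fstar) := hstep
      _ ≤ (1 - 2 * σ * γ) * ((1 - 2 * σ * γ) ^ k * (f (x 0) - fstar)) :=
        mul_le_mul_of_nonneg_left ih (by linarith)
      _ = (1 - 2 * σ * γ) ^ (k + 1) * (f (x 0) - fstar) := by ring
end

section
/- Let f : ℝ^n → ℝ be continuously differentiable with L-Lipschitz gradient, let P be a real n×m matrix each of whose columns has Euclidean norm at most 1, let ε > 0 and x ∈ ℝ^n. Define the finite-difference subspace gradient ∇_{P,ε}f(x) ∈ ℝ^m by (∇_{P,ε}f(x))_i = (f(x + εPe_i) − f(x − εPe_i))/(2ε) for i = 1,…,m. Then ‖∇_{P,ε}f(x) − Pᵀ∇f(x)‖ ≤ 2 m² L ε. -/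
open Matrix

/-- The finite-difference subspace gradient: `(∇_{P,ε}f(x))_i = (f(x+εPe_i) - f(x-εPe_i))/(2ε)`. -/
noncomputable def fdGrad {n m : ℕ} (f : EuclideanSpace ℝ (Fin n) → ℝ)
    (P : Matrix (Fin n) (Fin m) ℝ) (ε : ℝ) (x : EuclideanSpace ℝ (Fin n)) :
    EuclideanSpace ℝ (Fin m) :=
  (EuclideanSpace.equiv (Fin m) ℝ).symm fun i =>
    (f (x + ε • Matrix.toEuclideanLin P (EuclideanSpace.single i (1 : ℝ))) -
      f (x - ε • Matrix.toEuclideanLin P (EuclideanSpace.single i (1 : ℝ)))) / (2 * ε)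

/-- The symmetric difference quotient of a function with `L`-Lipschitz gradient approximates the
directional derivative up to `L * ε`, for directions of norm at most one. -/
theorem abs_symmetric_slope_sub_inner_gradient_le {F : Type*} [NormedAddCommGroup F]
    [InnerProductSpace ℝ F] [CompleteSpace F] {f : F → ℝ} {L : ℝ} (hL : 0 ≤ L)
    (hf : Differentiable ℝ f) (hlip : ∀ u v, ‖gradient f u - gradient f v‖ ≤ L * ‖u - v‖)
    {ε : ℝ} (hε : 0 < ε) (x : F) {d : F} (hd : ‖d‖ ≤ 1) :
    |(f (x + ε • d) - f (x - ε • d)) / (2 * ε) - inner ℝ (gradient f x) d| ≤ L * ε := by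
  have hεd : ‖ε • d‖ ≤ ε := by
    rw [norm_smul, Real.norm_of_nonneg hε.le]
    exact mul_le_of_le_one_right hε.le hd
  have hmvt := (convex_closedBall x ε).norm_image_sub_le_of_norm_hasFDerivWithin_le'
    (f := f) (f' := fderiv ℝ f) (φ := fderiv ℝ f x) (C := L * ε)
    (x := x - ε • d) (y := x + ε • d)
    (fun y _ => (hf y).hasFDerivAt.hasFDerivWithinAt)
    (fun y hy => by
      rw [← toDual_gradient, ← toDual_gradient, ← map_sub, LinearIsometryEquiv.norm_map]
      exact (hlip y x).trans (mul_le_mul_of_nonneg_left (mem_closedBall_iff_norm.1 hy) hL))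
    (by simpa [mem_closedBall_iff_norm] using hεd)
    (by simpa [mem_closedBall_iff_norm] using hεd)
  have hdir : x + ε • d - (x - ε • d) = (2 * ε) • d := by module
  rw [hdir, map_smul, ← toDual_gradient, InnerProductSpace.toDual_apply_apply, smul_eq_mul,
    Real.norm_eq_abs, norm_smul, Real.norm_of_nonneg (by positivity : 0 ≤ 2 * ε)] at hmvt
  have hquot : (f (x + ε • d) - f (x - ε • d)) / (2 * ε) - inner ℝ (gradient f x) d =
      (f (x + ε • d) - f (x - ε • d) - 2 * ε * inner ℝ (gradient f x) d) / (2 * ε) := by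
    field_simp
  rw [hquot, abs_div, abs_of_pos (by positivity : 0 < 2 * ε), div_le_iff₀ (by positivity)]
  refine hmvt.trans (mul_le_mul_of_nonneg_left ?_ (by positivity))
  exact mul_le_of_le_one_right (by positivity) hd

theorem EuclideanSpace.norm_le_card_mul {ι : Type*} [Fintype ι] (v : EuclideanSpace ℝ ι)
    {C : ℝ} (h : ∀ i, |v i| ≤ C) : ‖v‖ ≤ Fintype.card ι * C := by
  classical
  calc ‖v‖ = ‖∑ i, v i • EuclideanSpace.single i (1 : ℝ)‖ := by
        congr 1
        simpa using ((EuclideanSpace.basisFun ι ℝ).sum_repr v).symm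
    _ ≤ ∑ i, ‖v i • EuclideanSpace.single i (1 : ℝ)‖ := norm_sum_le _ _
    _ ≤ ∑ _i : ι, C := Finset.sum_le_sum fun i _ => by simpa [norm_smul] using h i
    _ = Fintype.card ι * C := by simp

theorem Matrix.toEuclideanLin_transpose_apply_eq_inner {n m : ℕ} (P : Matrix (Fin n) (Fin m) ℝ)
    (g : EuclideanSpace ℝ (Fin n)) (i : Fin m) :
    Matrix.toEuclideanLin Pᵀ g i =
      inner ℝ g (Matrix.toEuclideanLin P (EuclideanSpace.single i (1 : ℝ))) := by
  simp [Matrix.toLpLin_apply, Matrix.mulVec, dotProduct, PiLp.inner_apply]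


/-- For `f` continuously differentiable with `L`-Lipschitz gradient and `P` an `n×m` matrix whose
columns have Euclidean norm at most 1, `‖∇_{P,ε}f(x) - Pᵀ∇f(x)‖ ≤ 2 m² L ε`. -/
theorem stmt11 {n m : ℕ} (f : EuclideanSpace ℝ (Fin n) → ℝ)
    (L : ℝ) (hL : 0 < L) (hf : ContDiff ℝ 1 f)
    (hlip : ∀ u v : EuclideanSpace ℝ (Fin n),
      ‖gradient f u - gradient f v‖ ≤ L * ‖u - v‖)
    (P : Matrix (Fin n) (Fin m) ℝ)
    (hcol : ∀ j : Fin m, ‖Matrix.toEuclideanLin P (EuclideanSpace.single j (1 : ℝ))‖ ≤ 1)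
    (ε : ℝ) (hε : 0 < ε) (x : EuclideanSpace ℝ (Fin n)) :
    ‖fdGrad f P ε x - Matrix.toEuclideanLin Pᵀ (gradient f x)‖ ≤
      2 * (m : ℝ) ^ 2 * L * ε := by
  have hcoord : ∀ i, |(fdGrad f P ε x - Matrix.toEuclideanLin Pᵀ (gradient f x)) i| ≤ L * ε := by
    intro i
    rw [PiLp.sub_apply, Matrix.toEuclideanLin_transpose_apply_eq_inner]
    exact abs_symmetric_slope_sub_inner_gradient_le hL.le (hf.differentiable one_ne_zero) hlip
      hε x (hcol i)
  have hm : (m : ℝ) ≤ 2 * (m : ℝ) ^ 2 := by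
    have : m ≤ 2 * m ^ 2 := by nlinarith [Nat.le_self_pow two_ne_zero m]
    exact_mod_cast this
  calc ‖fdGrad f P ε x - Matrix.toEuclideanLin Pᵀ (gradient f x)‖
      ≤ m * (L * ε) := by simpa using EuclideanSpace.norm_le_card_mul _ hcoord
    _ ≤ 2 * (m : ℝ) ^ 2 * (L * ε) := mul_le_mul_of_nonneg_right hm (by positivity)
    _ = 2 * (m : ℝ) ^ 2 * L * ε := by ring
end

section
/- Let f : ℝ^n → ℝ be continuously differentiable with L-Lipschitz gradient, let P be a real n×m matrix each of whose columns has Euclidean norm at most 1, let ε > 0, x ∈ ℝ^n, d ∈ ℝ^m, α > 0, and let ∇_{P,ε}f(x) be the finite-difference subspace gradient. Then f(x + αPd) ≤ f(x) + α (∇_{P,ε}f(x))ᵀ d + α² (L m / 2) ‖d‖² + 2 m² L ε α ‖d‖. -/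
open Matrix
open scoped RealInnerProductSpace

/-- Quadratic Taylor bound for a differentiable function with Lipschitz gradient. -/
theorem abs_sub_sub_inner_gradient_le {E : Type*} [NormedAddCommGroup E] [InnerProductSpace ℝ E]
    [CompleteSpace E] {f : E → ℝ} {L : ℝ} (hf : Differentiable ℝ f)
    (hlip : ∀ u v : E, ‖gradient f u - gradient f v‖ ≤ L * ‖u - v‖) (y h : E) :
    |f (y + h) - f y - ⟪gradient f y, h⟫| ≤ L / 2 * ‖h‖ ^ 2 := by
  have hderiv : ∀ t : ℝ, HasDerivAt (fun t : ℝ => f (y + t • h) - f y - t * ⟪gradient f y, h⟫)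
      (⟪gradient f (y + t • h), h⟫ - ⟪gradient f y, h⟫) t := by
    intro t
    have hline : HasDerivAt (fun t : ℝ => y + t • h) h t := by
      simpa using ((hasDerivAt_id t).smul_const h).const_add y
    have hcomp := (hf (y + t • h)).hasGradientAt.hasFDerivAt.comp_hasDerivAt t hline
    refine ((hcomp.sub_const (f y)).sub
      ((hasDerivAt_id t).mul_const ⟪gradient f y, h⟫)).congr_deriv ?_
    simp
  have hbound : ∀ t : ℝ, HasDerivAt (fun t : ℝ => L / 2 * ‖h‖ ^ 2 * t ^ 2)
      (L * ‖h‖ ^ 2 * t) t := by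
    intro t
    refine ((hasDerivAt_pow 2 t).const_mul (L / 2 * ‖h‖ ^ 2)).congr_deriv ?_
    norm_num
    ring
  have key := image_norm_le_of_norm_deriv_right_le_deriv_boundary (a := 0) (b := 1)
    (fun t _ => (hderiv t).continuousAt.continuousWithinAt)
    (fun t _ => (hderiv t).hasDerivWithinAt) (by simp) hbound
    (fun t ht => by
      rw [← inner_sub_left]
      calc ‖⟪gradient f (y + t • h) - gradient f y, h⟫‖
          ≤ ‖gradient f (y + t • h) - gradient f y‖ * ‖h‖ := norm_inner_le_norm _ _
        _ ≤ L * ‖y + t • h - y‖ * ‖h‖ := by gcongr; exact hlip _ _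
        _ = L * ‖h‖ ^ 2 * t := by
          rw [add_sub_cancel_left, norm_smul, Real.norm_of_nonneg ht.1]; ring)
    (Set.right_mem_Icc.2 zero_le_one)
  simpa using key

/-- Error of the central difference quotient for a function with Lipschitz gradient. -/
theorem abs_inner_gradient_sub_centralDiff_le {E : Type*} [NormedAddCommGroup E]
    [InnerProductSpace ℝ E] [CompleteSpace E] {f : E → ℝ} {L : ℝ} (hf : Differentiable ℝ f)
    (hlip : ∀ u v : E, ‖gradient f u - gradient f v‖ ≤ L * ‖u - v‖) {ε : ℝ} (hε : 0 < ε)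
    (x v : E) :
    |⟪gradient f x, v⟫ - (f (x + ε • v) - f (x - ε • v)) / (2 * ε)| ≤ L / 2 * ε * ‖v‖ ^ 2 := by
  have hp := abs_sub_sub_inner_gradient_le hf hlip x (ε • v)
  have hm := abs_sub_sub_inner_gradient_le hf hlip x (-(ε • v))
  rw [inner_neg_right, norm_neg, ← sub_eq_add_neg] at hm
  rw [norm_smul, Real.norm_of_nonneg hε.le, inner_smul_right, abs_le] at hp hm
  have hq : (f (x + ε • v) - f (x - ε • v)) / (2 * ε) * (2 * ε) =
      f (x + ε • v) - f (x - ε • v) := by field_simp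
  rw [abs_le]
  constructor <;> refine le_of_mul_le_mul_right ?_ (by positivity : 0 < 2 * ε) <;> nlinarith

theorem EuclideanSpace.sum_abs_sq_le {m : ℕ} (d : EuclideanSpace ℝ (Fin m)) :
    (∑ i, |d i|) ^ 2 ≤ m * ‖d‖ ^ 2 := by
  simpa [EuclideanSpace.norm_sq_eq] using
    sq_sum_le_card_mul_sum_sq (s := Finset.univ) (f := fun i => |d i|)

theorem EuclideanSpace.sum_abs_le {m : ℕ} (d : EuclideanSpace ℝ (Fin m)) :
    ∑ i, |d i| ≤ m * ‖d‖ := by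
  simpa using Finset.sum_le_card_nsmul Finset.univ (fun i => |d i|) ‖d‖
    (fun i _ => PiLp.norm_apply_le d i)

theorem EuclideanSpace.map_eq_sum_smul_single {E : Type*} [AddCommGroup E] [Module ℝ E] {m : ℕ}
    (Q : EuclideanSpace ℝ (Fin m) →ₗ[ℝ] E) (d : EuclideanSpace ℝ (Fin m)) :
    Q d = ∑ i, d i • Q (EuclideanSpace.single i (1 : ℝ)) := by
  conv_lhs => rw [← (EuclideanSpace.basisFun (Fin m) ℝ).sum_repr d]
  simp

/-- For `f` continuously differentiable with `L`-Lipschitz gradient, `P` with columns of norm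
at most 1, `ε > 0`, `α > 0` and `d ∈ ℝ^m`:
`f(x + αPd) ≤ f(x) + α (∇_{P,ε}f(x))ᵀ d + α² (L m / 2)‖d‖² + 2 m² L ε α ‖d‖`. -/
theorem stmt14 {n m : ℕ} (f : EuclideanSpace ℝ (Fin n) → ℝ)
    (L : ℝ) (hL : 0 < L) (hf : ContDiff ℝ 1 f)
    (hlip : ∀ u v : EuclideanSpace ℝ (Fin n),
      ‖gradient f u - gradient f v‖ ≤ L * ‖u - v‖)
    (P : Matrix (Fin n) (Fin m) ℝ)
    (hcol : ∀ j : Fin m, ‖Matrix.toEuclideanLin P (EuclideanSpace.single j (1 : ℝ))‖ ≤ 1)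
    (ε : ℝ) (hε : 0 < ε) (x : EuclideanSpace ℝ (Fin n))
    (d : EuclideanSpace ℝ (Fin m)) (α : ℝ) (hα : 0 < α) :
    f (x + α • Matrix.toEuclideanLin P d) ≤
      f x + α * ⟪fdGrad f P ε x, d⟫ + α ^ 2 * (L * m / 2) * ‖d‖ ^ 2 +
        2 * (m : ℝ) ^ 2 * L * ε * α * ‖d‖ := by
  have hdiff : Differentiable ℝ f := hf.differentiable one_ne_zero
  set Q := Matrix.toEuclideanLin P
  have hQd := EuclideanSpace.map_eq_sum_smul_single Q d
  have hnorm : ‖Q d‖ ^ 2 ≤ m * ‖d‖ ^ 2 := by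
    refine le_trans ?_ (EuclideanSpace.sum_abs_sq_le d)
    gcongr
    rw [hQd]
    refine norm_sum_le_of_le _ fun i _ => ?_
    rw [norm_smul, Real.norm_eq_abs]
    exact mul_le_of_le_one_right (abs_nonneg _) (hcol i)
  have hinner : ⟪gradient f x, Q d⟫ - ⟪fdGrad f P ε x, d⟫ ≤ L / 2 * ε * (m * ‖d‖) := by
    have hsum : ⟪gradient f x, Q d⟫ - ⟪fdGrad f P ε x, d⟫ =
        ∑ i, d i * (⟪gradient f x, Q (EuclideanSpace.single i (1 : ℝ))⟫ - fdGrad f P ε x i) := by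
      simp [hQd, inner_sum, inner_smul_right, PiLp.inner_apply, mul_sub, Finset.sum_sub_distrib]
    rw [hsum]
    calc _ ≤ ∑ i, L / 2 * ε * |d i| := by
          refine Finset.sum_le_sum fun i _ => (le_abs_self _).trans ?_
          rw [abs_mul, mul_comm]
          gcongr
          refine (abs_inner_gradient_sub_centralDiff_le hdiff hlip hε x _).trans ?_
          exact mul_le_of_le_one_right (by positivity) (pow_le_one₀ (norm_nonneg _) (hcol i))
      _ ≤ L / 2 * ε * (m * ‖d‖) := by
          rw [← Finset.mul_sum]
          gcongr
          exact EuclideanSpace.sum_abs_le d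
  have htaylor := (abs_le.1 (abs_sub_sub_inner_gradient_le hdiff hlip x (α • Q d))).2
  rw [norm_smul, Real.norm_of_nonneg hα.le, inner_smul_right, mul_pow] at htaylor
  have hquad : L / 2 * (α ^ 2 * ‖Q d‖ ^ 2) ≤ α ^ 2 * (L * m / 2) * ‖d‖ ^ 2 := by
    calc _ ≤ L / 2 * (α ^ 2 * (m * ‖d‖ ^ 2)) := by gcongr
      _ = _ := by ring
  have hm : (m : ℝ) ≤ (m : ℝ) ^ 2 := by exact_mod_cast Nat.le_self_pow two_ne_zero m
  have herr : α * (L / 2 * ε * (m * ‖d‖)) ≤ 2 * (m : ℝ) ^ 2 * L * ε * α * ‖d‖ := by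
    have hc : 0 ≤ L * ε * α * ‖d‖ := by positivity
    nlinarith [mul_le_mul_of_nonneg_right hm hc, mul_nonneg (Nat.cast_nonneg (α := ℝ) m) hc]
  linarith [mul_le_mul_of_nonneg_left hinner hα.le]
end

section
/- Let f : ℝ^n → ℝ be differentiable and bounded below by f*, let γ > 0, K ≥ 0, ε ≥ 0, and let (x_k)_{k≥0} be a sequence in ℝ^n such that for every k: f(x_{k+1}) ≤ f(x_k), and moreover f(x_{k+1}) − f(x_k) ≤ −γ ‖∇f(x_k)‖² whenever ‖∇f(x_k)‖ ≥ Kε. Then for every k ≥ 0, min_{0 ≤ j ≤ k} ‖∇f(x_j)‖ ≤ √( (f(x₀) − f*) / (γ(k+1)) + K²ε² ). -/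
/-- A nonincreasing sequence whose decrease is at least `γ * g k ^ 2` whenever `g k ≥ c` loses at
least `N * (γ * (m ^ 2 - c ^ 2))` over the first `N` steps, if `m` is a lower bound of `g` there. -/
theorem natCast_mul_le_sub_of_sufficient_decrease {a g : ℕ → ℝ} {γ c m : ℝ} (hγ : 0 < γ)
    (hm : 0 ≤ m) (hmono : ∀ k, a (k + 1) ≤ a k)
    (hdec : ∀ k, c ≤ g k → a (k + 1) - a k ≤ -γ * g k ^ 2) (N : ℕ)
    (hmg : ∀ j < N, m ≤ g j) :
    N * (γ * (m ^ 2 - c ^ 2)) ≤ a 0 - a N := by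
  induction N with
  | zero => simp
  | succ N ih =>
    have hsum := ih fun j hj => hmg j (by lia)
    have hmN := hmg N (by lia)
    have hstep : γ * (m ^ 2 - c ^ 2) ≤ a N - a (N + 1) := by
      rcases le_or_gt c (g N) with h | h
      · have hsq : m ^ 2 ≤ g N ^ 2 := by gcongr
        nlinarith [hdec N h, mul_le_mul_of_nonneg_left hsq hγ.le, mul_nonneg hγ.le (sq_nonneg c)]
      · have hsq : m ^ 2 ≤ c ^ 2 := by gcongr; linarith
        nlinarith [hmono N, mul_le_mul_of_nonneg_left hsq hγ.le]
    push_cast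
    linarith

/-- Let `f` be differentiable and bounded below by `f*`, `γ > 0`, `K ≥ 0`, `ε ≥ 0`, and `(x_k)` a
sequence with `f(x_{k+1}) ≤ f(x_k)` for all `k` and `f(x_{k+1}) - f(x_k) ≤ -γ‖∇f(x_k)‖²`
whenever `‖∇f(x_k)‖ ≥ Kε`. Then for every `k`,
`min_{0 ≤ j ≤ k} ‖∇f(x_j)‖ ≤ √((f(x₀) - f*)/(γ(k+1)) + K²ε²)`. -/
theorem stmt17 {n : ℕ} (f : EuclideanSpace ℝ (Fin n) → ℝ)
    (hf : Differentiable ℝ f)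
    (fstar : ℝ) (hbound : ∀ y, fstar ≤ f y)
    (γ : ℝ) (hγ : 0 < γ) (K : ℝ) (hK : 0 ≤ K) (ε : ℝ) (hε : 0 ≤ ε)
    (x : ℕ → EuclideanSpace ℝ (Fin n))
    (hmono : ∀ k : ℕ, f (x (k + 1)) ≤ f (x k))
    (hdec : ∀ k : ℕ, K * ε ≤ ‖gradient f (x k)‖ →
      f (x (k + 1)) - f (x k) ≤ -γ * ‖gradient f (x k)‖ ^ 2) :
    ∀ k : ℕ,
      (Finset.range (k + 1)).inf' (by simp) (fun j => ‖gradient f (x j)‖) ≤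
        Real.sqrt ((f (x 0) - fstar) / (γ * (k + 1)) + K ^ 2 * ε ^ 2) := by
  intro k
  set m := (Finset.range (k + 1)).inf' (by simp) (fun j => ‖gradient f (x j)‖)
  have hm : 0 ≤ m := Finset.le_inf' _ _ fun j _ => norm_nonneg _
  have hmg : ∀ j < k + 1, m ≤ ‖gradient f (x j)‖ := fun j hj =>
    Finset.inf'_le (fun j => ‖gradient f (x j)‖) (Finset.mem_range.2 hj)
  have hsum := natCast_mul_le_sub_of_sufficient_decrease (a := fun j => f (x j)) hγ hm hmono hdec
    (k + 1) hmg
  push_cast at hsum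
  apply Real.le_sqrt_of_sq_le
  rw [← sub_le_iff_le_add, le_div_iff₀ (by positivity)]
  linarith [hbound (x (k + 1))]
end

section
/- Let (Δ_k)_{k≥0} be a sequence of nonnegative reals that is nonincreasing, let γ > 0 and b ≥ 0, and suppose that for every k with Δ_k ≥ b one has Δ_{k+1} ≤ Δ_k − γ Δ_k². Then for every k ≥ 0, Δ_k ≤ Δ₀ / (1 + γ k Δ₀) + b. -/
/-- One step of the recursion `y ≤ x - γx²`: a bound `x ≤ D / A` becomes `y ≤ D / (A + γD)`. -/
theorem mul_add_le_of_le_sub_sq {x y A D γ : ℝ} (hx : 0 < x) (hy : 0 ≤ y) (hA : 0 ≤ A)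
    (hD : 0 ≤ D) (hγ : 0 ≤ γ) (hyx : y ≤ x - γ * x ^ 2) (hxA : x * A ≤ D) :
    y * (A + γ * D) ≤ D := by
  have hfactor : 0 ≤ 1 - γ * x := by
    have h : 0 ≤ x * (1 - γ * x) := by linarith
    exact nonneg_of_mul_nonneg_right h hx
  calc y * (A + γ * D) ≤ (x - γ * x ^ 2) * (A + γ * D) := by gcongr
    _ = x * A * (1 - γ * x) + γ * x * D * (1 - γ * x) := by ring
    _ ≤ D * (1 - γ * x) + γ * x * D * (1 - γ * x) := by gcongr
    _ = D - D * (γ * x) ^ 2 := by ring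
    _ ≤ D := sub_le_self _ (by positivity)

/-- Let `(Δ_k)` be a nonincreasing sequence of nonnegative reals, `γ > 0`, `b ≥ 0`, and suppose
`Δ_{k+1} ≤ Δ_k - γΔ_k²` whenever `Δ_k ≥ b`. Then `Δ_k ≤ Δ₀/(1 + γ k Δ₀) + b` for all `k`. -/
theorem stmt18 (Δ : ℕ → ℝ) (hnonneg : ∀ k, 0 ≤ Δ k)
    (hmono : ∀ k, Δ (k + 1) ≤ Δ k)
    (γ : ℝ) (hγ : 0 < γ) (b : ℝ) (hb : 0 ≤ b)
    (hrec : ∀ k, b ≤ Δ k → Δ (k + 1) ≤ Δ k - γ * Δ k ^ 2) :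
    ∀ k : ℕ, Δ k ≤ Δ 0 / (1 + γ * k * Δ 0) + b := by
  have h0 := hnonneg 0
  have key : ∀ k : ℕ, Δ k ≤ b ∨ Δ k * (1 + γ * k * Δ 0) ≤ Δ 0 := by
    intro k
    induction k with
    | zero => right; simp
    | succ k ih =>
      rcases le_or_gt (Δ k) b with hk | hk
      · exact Or.inl ((hmono k).trans hk)
      · right
        have h := mul_add_le_of_le_sub_sq (hb.trans_lt hk) (hnonneg (k + 1))
          (by positivity) h0 hγ.le (hrec k hk.le) (ih.resolve_left hk.not_ge)
        convert h using 2
        push_cast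
        ring
  intro k
  have hpos : 0 < 1 + γ * k * Δ 0 := by positivity
  rcases key k with h | h
  · exact h.trans (le_add_of_nonneg_left (by positivity))
  · exact ((le_div_iff₀ hpos).2 h).trans (le_add_of_nonneg_right hb)
end
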